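/- Let f : ℝ × ℝ^N → ℝ^N be Lipschitz Carathéodory with L¹_loc-equicontinuous m-bounds, and let Θ = {θ_j^I} be the suitable set of moduli of continuity defined by θ_j^I(s) := sup_{t ∈ ℝ} ∫_t^{t+s} m^j(u) du, where m^j(t) = sup_{|x|≤j} |f(t,x)| is the optimal m-bound of f on B_j. Assume that for every r ∈ ℝ and every x₀ ∈ ℝ^N the solution x(·, f_r, x₀) is defined on [0,∞), and that there exists R > 0 such that for every d > 0 there is T(d) > 0 with |x(s, f_{t−s}, x₀)| ≤ R whenever t ∈ ℝ, s ≥ T(d) and |x₀| ≤ d (a bounded pullback absorbing set for the process induced by f). Let g be Lipschitz Carathéodory which is either a translate f_r of f or a σ_Θ-limit of a sequence of translates f_{t_n}, and assume all solutions x(·, g_r, x₀) are defined on [0,∞). Then the solutions of ẋ = g(t,x) are uniformly ultimately bounded: for every d > 0 there is T'(d) > 0 such that |x(t, g_r, x₀)| ≤ R for every r ∈ ℝ, every t ≥ T'(d), and every x₀ with |x₀| ≤ d. -/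

import Mathlib

open MeasureTheory Set Filter Topology
open scoped RealInnerProductSpace

noncomputable section

abbrev Euc (n : ℕ) := EuclideanSpace ℝ (Fin n)

/-- A function `ℝ → ℝ` is locally integrable (w.r.t. Lebesgue measure) on every
compact interval. -/
def LocInt (m : ℝ → ℝ) : Prop := ∀ a b : ℝ, IntegrableOn m (Icc a b)

section Defs

variable {N : ℕ} {F : Type*} [NormedAddCommGroup F] [NormedSpace ℝ F]

/-- The Carathéodory conditions (C1) and (C2). -/
def IsCara (f : ℝ → Euc N → F) : Prop :=
  StronglyMeasurable (Function.uncurry f) ∧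
  ∀ K : Set (Euc N), IsCompact K → ∃ m : ℝ → ℝ, (∀ t, 0 ≤ m t) ∧ LocInt m ∧
    ∀ᵐ t : ℝ, ∀ x ∈ K, ‖f t x‖ ≤ m t

/-- A suitable set of moduli of continuity `Θ = {θ_j^{[q₁,q₂]}}`. -/
structure SuitableModuli where
  θ : ℕ → ℚ → ℚ → ℝ → ℝ
  nonneg : ∀ j q₁ q₂ s, (0:ℝ) ≤ s → 0 ≤ θ j q₁ q₂ s
  cont : ∀ j q₁ q₂, ContinuousOn (θ j q₁ q₂) (Ici 0)
  mono : ∀ j q₁ q₂, MonotoneOn (θ j q₁ q₂) (Ici 0)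
  zero : ∀ j q₁ q₂, θ j q₁ q₂ 0 = 0
  ordered : ∀ j₁ j₂ q₁ q₂ p₁ p₂, j₁ ≤ j₂ → p₁ ≤ q₁ → q₂ ≤ p₂ →
    ∀ s : ℝ, 0 ≤ s → θ j₁ q₁ q₂ s ≤ θ j₂ p₁ p₂ s

/-- `x ∈ K_j^{[q₁,q₂]}`: continuous, bounded by `j` and with modulus of continuity
`θ_j^{[q₁,q₂]}` on `[q₁,q₂]`. -/
def inK {N : ℕ} (Θ : SuitableModuli) (j : ℕ) (q₁ q₂ : ℚ) (x : ℝ → Euc N) : Prop :=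
  ContinuousOn x (Icc (q₁:ℝ) (q₂:ℝ)) ∧
  (∀ t ∈ Icc (q₁:ℝ) (q₂:ℝ), ‖x t‖ ≤ (j:ℝ)) ∧
  ∀ t ∈ Icc (q₁:ℝ) (q₂:ℝ), ∀ s ∈ Icc (q₁:ℝ) (q₂:ℝ), ‖x t - x s‖ ≤ Θ.θ j q₁ q₂ |t - s|

/-- Weak Θ-Carathéodory functions: Carathéodory conditions plus condition (W). -/
def IsWTC (Θ : SuitableModuli) (f : ℝ → Euc N → F) : Prop :=
  IsCara f ∧
  ∀ (j : ℕ) (q₁ q₂ : ℚ) (xs : ℕ → ℝ → Euc N) (x : ℝ → Euc N),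
    (∀ n, inK Θ j q₁ q₂ (xs n)) → inK Θ j q₁ q₂ x →
    TendstoUniformlyOn (fun n t => xs n t) x atTop (Icc (q₁:ℝ) (q₂:ℝ)) →
    Tendsto (fun n => ∫ t in Icc (q₁:ℝ) (q₂:ℝ), f t (xs n t)) atTop
      (𝓝 (∫ t in Icc (q₁:ℝ) (q₂:ℝ), f t (x t)))

/-- Convergence in the `σ_Θ` sense:
`sup_{x ∈ K_j^I} ‖∫_I (f_n(t,x(t)) − f(t,x(t))) dt‖ → 0` for every `j` and `I`. -/
def SigmaTendsto (Θ : SuitableModuli) (fs : ℕ → ℝ → Euc N → F) (f : ℝ → Euc N → F) : Prop :=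
  ∀ (j : ℕ) (q₁ q₂ : ℚ), ∀ ε > (0:ℝ), ∀ᶠ n in atTop, ∀ x : ℝ → Euc N, inK Θ j q₁ q₂ x →
    ‖∫ t in Icc (q₁:ℝ) (q₂:ℝ), (fs n t (x t) - f t (x t))‖ < ε

end Defs

/-- Lipschitz Carathéodory functions. -/
def IsLC {N : ℕ} (f : ℝ → Euc N → Euc N) : Prop :=
  IsCara f ∧
  ∀ K : Set (Euc N), IsCompact K → ∃ l : ℝ → ℝ, LocInt l ∧
    ∀ᵐ t : ℝ, ∀ x ∈ K, ∀ y ∈ K, ‖f t x - f t y‖ ≤ l t * ‖x - y‖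

/-- The optimal m-bound of `f` on the closed ball `B_j`. -/
def mOpt {N : ℕ} (f : ℝ → Euc N → Euc N) (j : ℕ) (t : ℝ) : ℝ :=
  sSup {v : ℝ | ∃ x : Euc N, ‖x‖ ≤ (j:ℝ) ∧ v = ‖f t x‖}

/-- The time translation `f_r(s,x) = f(s+r,x)`. -/
def timeTranslate {N : ℕ} (f : ℝ → Euc N → Euc N) (r : ℝ) : ℝ → Euc N → Euc N :=
  fun s x => f (s + r) x

/-- `x` is a solution of `ẋ = g(t,x)`, `x(0) = x₀`, defined on `[0,∞)`. -/
def IsSolOn {N : ℕ} (g : ℝ → Euc N → Euc N) (x₀ : Euc N) (x : ℝ → Euc N) : Prop :=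
  ContinuousOn x (Ici 0) ∧ ∀ t ∈ Ici (0:ℝ), x t = x₀ + ∫ s in (0:ℝ)..t, g s (x s)

section Auxiliary

variable {N : ℕ}

lemma LocInt.intervalIntegrable {m : ℝ → ℝ} (hm : LocInt m) (a b : ℝ) :
    IntervalIntegrable m volume a b := by
  rw [intervalIntegrable_iff']
  exact hm _ _

lemma LocInt.translate {m : ℝ → ℝ} (hm : LocInt m) (r : ℝ) : LocInt fun t => m (t + r) := by
  intro a b
  rcases le_or_gt a b with hab | hab
  · rw [← uIcc_of_le hab, ← intervalIntegrable_iff']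
    simpa using (hm.intervalIntegrable (a + r) (b + r)).comp_add_right r
  · simp [Icc_eq_empty_of_lt hab]

lemma ae_translate {p : ℝ → Prop} (h : ∀ᵐ t : ℝ, p t) (r : ℝ) : ∀ᵐ t : ℝ, p (t + r) :=
  (measurePreserving_add_right volume r).quasiMeasurePreserving.ae h

lemma IsLC.translate {f : ℝ → Euc N → Euc N} (hf : IsLC f) (r : ℝ) :
    IsLC (timeTranslate f r) := by
  obtain ⟨⟨hmeas, hbd⟩, hlip⟩ := hf
  refine ⟨⟨?_, fun K hK => ?_⟩, fun K hK => ?_⟩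
  · exact hmeas.comp_measurable (g := fun p : ℝ × Euc N => (p.1 + r, p.2)) (by fun_prop)
  · obtain ⟨m, hm0, hm, hb⟩ := hbd K hK
    exact ⟨fun t => m (t + r), fun t => hm0 _, hm.translate r, ae_translate hb r⟩
  · obtain ⟨l, hl, hb⟩ := hlip K hK
    exact ⟨fun t => l (t + r), hl.translate r, ae_translate hb r⟩

/-- The set whose supremum is the optimal m-bound is bounded for almost every time, and the
optimal m-bound is dominated by a locally integrable function. -/
lemma IsLC.exists_mOpt_le {f : ℝ → Euc N → Euc N} (hf : IsLC f) (j : ℕ) :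
    ∃ m : ℝ → ℝ, LocInt m ∧ ∀ᵐ t : ℝ, (∀ x : Euc N, ‖x‖ ≤ j → ‖f t x‖ ≤ mOpt f j t) ∧
      0 ≤ mOpt f j t ∧ mOpt f j t ≤ m t := by
  obtain ⟨m, hm0, hm, hb⟩ := hf.1.2 (Metric.closedBall 0 j) (isCompact_closedBall _ _)
  refine ⟨m, hm, ?_⟩
  filter_upwards [hb] with t ht
  have hle : ∀ x : Euc N, ‖x‖ ≤ j → ‖f t x‖ ≤ mOpt f j t := fun x hx =>
    le_csSup ⟨m t, by rintro v ⟨y, hy, rfl⟩; exact ht y (by simpa using hy)⟩ ⟨x, hx, rfl⟩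
  refine ⟨hle, (norm_nonneg _).trans (hle 0 (by simp)), ?_⟩
  refine csSup_le ⟨_, 0, by simp, rfl⟩ ?_
  rintro v ⟨y, hy, rfl⟩
  exact ht y (by simpa using hy)

lemma IsLC.ae_norm_le_mOpt {f : ℝ → Euc N → Euc N} (hf : IsLC f) (j : ℕ) :
    ∀ᵐ t : ℝ, ∀ x : Euc N, ‖x‖ ≤ j → ‖f t x‖ ≤ mOpt f j t := by
  obtain ⟨m, -, h⟩ := hf.exists_mOpt_le j
  exact h.mono fun t ht => ht.1

lemma IsLC.aemeasurable_mOpt {f : ℝ → Euc N → Euc N} (hf : IsLC f) (j : ℕ) :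
    AEMeasurable (mOpt f j) := by
  have : Nonempty (Metric.closedBall (0 : Euc N) (j : ℝ)) := ⟨⟨0, by simp⟩⟩
  let e := TopologicalSpace.denseSeq (Metric.closedBall (0 : Euc N) (j : ℝ))
  refine ⟨fun t => ⨆ n, ‖f t (e n)‖, ?_, ?_⟩
  · refine Measurable.iSup fun n => ?_
    exact ((hf.1.1.comp_measurable
      (g := fun t : ℝ => (t, (e n : Euc N))) (by fun_prop)).norm).measurable
  · obtain ⟨l, -, hl⟩ := hf.2 (Metric.closedBall 0 j) (isCompact_closedBall _ _)
    filter_upwards [hf.ae_norm_le_mOpt j, hl] with t ht hlt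
    have hbdd : BddAbove (range fun n => ‖f t (e n)‖) :=
      ⟨mOpt f j t, by rintro _ ⟨n, rfl⟩; exact ht _ (mem_closedBall_zero_iff.1 (e n).2)⟩
    refine le_antisymm (csSup_le ⟨_, 0, by simp, rfl⟩ ?_)
      (ciSup_le fun n => ht _ (mem_closedBall_zero_iff.1 (e n).2))
    have hcont : Continuous fun x : Metric.closedBall (0 : Euc N) (j : ℝ) => ‖f t x‖ := by
      refine Continuous.norm (LipschitzWith.continuous (K := (l t).toNNReal) ?_)
      refine LipschitzWith.of_dist_le_mul fun x y => ?_
      rw [dist_eq_norm, Subtype.dist_eq, dist_eq_norm]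
      exact (hlt x x.2 y y.2).trans
        (mul_le_mul_of_nonneg_right (Real.le_coe_toNNReal _) (norm_nonneg _))
    rintro v ⟨y, hy, rfl⟩
    have hclosed : IsClosed {x : Metric.closedBall (0 : Euc N) (j : ℝ) |
        ‖f t x‖ ≤ ⨆ n, ‖f t (e n)‖} := isClosed_le hcont continuous_const
    exact (TopologicalSpace.denseRange_denseSeq _).induction_on
      (p := fun x : Metric.closedBall (0 : Euc N) (j : ℝ) => ‖f t x‖ ≤ ⨆ n, ‖f t (e n)‖)
      (⟨y, by simpa using hy⟩ : Metric.closedBall (0 : Euc N) (j : ℝ)) hclosed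
      fun n => le_ciSup hbdd n

lemma IsLC.locInt_mOpt {f : ℝ → Euc N → Euc N} (hf : IsLC f) (j : ℕ) : LocInt (mOpt f j) := by
  intro a b
  obtain ⟨m, hm, h⟩ := hf.exists_mOpt_le j
  refine (hm a b).mono' (hf.aemeasurable_mOpt j).aestronglyMeasurable.restrict ?_
  filter_upwards [ae_restrict_of_ae h] with t ht
  rw [Real.norm_of_nonneg ht.2.1]
  exact ht.2.2

lemma IsLC.mOpt_integral_nonneg {f : ℝ → Euc N → Euc N} (hf : IsLC f) (j : ℕ) {a b : ℝ}
    (hab : a ≤ b) : 0 ≤ ∫ u in a..b, mOpt f j u := by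
  obtain ⟨m, -, h⟩ := hf.exists_mOpt_le j
  exact intervalIntegral.integral_nonneg_of_ae hab (h.mono fun t ht => ht.2.1)

lemma IsLC.intervalIntegrable_comp {f : ℝ → Euc N → Euc N} (hf : IsLC f) {j : ℕ} {a b : ℝ}
    (hab : a ≤ b) {z : ℝ → Euc N} (hz : ContinuousOn z (Icc a b))
    (hzj : ∀ u ∈ Icc a b, ‖z u‖ ≤ j) :
    IntervalIntegrable (fun u => f u (z u)) volume a b := by
  rw [intervalIntegrable_iff', uIcc_of_le hab]
  refine (hf.locInt_mOpt j a b).mono' ?_ ?_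
  · exact hf.1.1.aestronglyMeasurable.comp_aemeasurable
      (aemeasurable_id.prodMk (hz.aemeasurable measurableSet_Icc))
  · filter_upwards [ae_restrict_of_ae (hf.ae_norm_le_mOpt j), ae_restrict_mem measurableSet_Icc]
      with t ht hmem
    exact ht _ (hzj t hmem)

lemma IsLC.norm_integral_comp_le {f : ℝ → Euc N → Euc N} (hf : IsLC f) {j : ℕ} {a b : ℝ}
    (hab : a ≤ b) {z : ℝ → Euc N} (hzj : ∀ u ∈ Icc a b, ‖z u‖ ≤ j) :
    ‖∫ u in a..b, f u (z u)‖ ≤ ∫ u in a..b, mOpt f j u := by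
  refine intervalIntegral.norm_integral_le_of_norm_le hab ?_
    ((hf.locInt_mOpt j).intervalIntegrable a b)
  filter_upwards [hf.ae_norm_le_mOpt j] with t ht hmem
  exact ht _ (hzj t (Ioc_subset_Icc_self hmem))

lemma LocInt.exists_abs_integral_lt {m : ℝ → ℝ} (hm : LocInt m) (a b : ℝ) {ε : ℝ} (hε : 0 < ε) :
    ∃ δ > 0, ∀ c ∈ Icc a b, ∀ d ∈ Icc a b, |d - c| < δ → |∫ u in c..d, m u| < ε := by
  have hcont : Continuous fun c => ∫ u in (0 : ℝ)..c, m u :=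
    intervalIntegral.continuous_primitive (fun a b => hm.intervalIntegrable a b) 0
  have huc := isCompact_Icc.uniformContinuousOn_of_continuous (hcont.continuousOn (s := Icc a b))
  obtain ⟨δ, hδ, h⟩ := Metric.uniformContinuousOn_iff.1 huc ε hε
  refine ⟨δ, hδ, fun c hc d hd hcd => ?_⟩
  have := h d hd c hc hcd
  rwa [Real.dist_eq, intervalIntegral.integral_interval_sub_left
    (hm.intervalIntegrable _ _) (hm.intervalIntegrable _ _)] at this

/-- Grönwall's inequality with a locally integrable coefficient, with an unspecified constant. -/
lemma LocInt.exists_gronwall {l : ℝ → ℝ} (hl : LocInt l) (hl0 : ∀ t, 0 ≤ l t) (T : ℝ) :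
    ∃ C : ℝ, 0 ≤ C ∧ ∀ b ∈ Icc 0 T, ∀ (u : ℝ → ℝ) (ε : ℝ), 0 ≤ ε → ContinuousOn u (Icc 0 b) →
      (∀ s ∈ Icc 0 b, 0 ≤ u s) → (∀ s ∈ Icc 0 b, u s ≤ ε + ∫ v in (0 : ℝ)..s, l v * u v) →
      ∀ s ∈ Icc 0 b, u s ≤ C * ε := by
  obtain ⟨δ, hδ, hsmall⟩ := hl.exists_abs_integral_lt 0 T (ε := 1 / 2) (by norm_num)
  have key : ∀ k : ℕ, ∃ C : ℝ, 0 ≤ C ∧ ∀ b ∈ Icc 0 T, b ≤ k * (δ / 2) → ∀ (u : ℝ → ℝ) (ε : ℝ),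
      0 ≤ ε → ContinuousOn u (Icc 0 b) → (∀ s ∈ Icc 0 b, 0 ≤ u s) →
      (∀ s ∈ Icc 0 b, u s ≤ ε + ∫ v in (0 : ℝ)..s, l v * u v) → ∀ s ∈ Icc 0 b, u s ≤ C * ε := by
    intro k
    induction k with
    | zero =>
      refine ⟨1, zero_le_one, fun b hb hbk u ε hε hu hu0 h s hs => ?_⟩
      have hs0 : s = 0 := by
        have := hs.1; have := hs.2; norm_num at hbk; linarith
      have := h s hs
      rw [hs0] at this ⊢
      simpa using this
    | succ k ih =>
      obtain ⟨C, hC, ih⟩ := ih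
      set Λ := ∫ v in (0 : ℝ)..|T|, l v with hΛ
      have hΛ0 : 0 ≤ Λ := intervalIntegral.integral_nonneg (abs_nonneg T) fun v _ => hl0 v
      refine ⟨2 * (1 + Λ * C) + C, by positivity, fun b hb hbk u ε hε hu hu0 h => ?_⟩
      have hint : ∀ c d, 0 ≤ c → c ≤ d → d ≤ b →
          IntervalIntegrable (fun v => l v * u v) volume c d := fun c d hc hcd hd =>
        (hl.intervalIntegrable c d).mul_continuousOn
          (hu.mono (by rw [uIcc_of_le hcd]; exact Icc_subset_Icc hc hd))
      have hmul : ∀ c d M, 0 ≤ c → c ≤ d → d ≤ b → (∀ v ∈ Icc c d, u v ≤ M) →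
          ∫ v in c..d, l v * u v ≤ (∫ v in c..d, l v) * M := by
        intro c d M hc hcd hd hM
        rw [← intervalIntegral.integral_mul_const]
        exact intervalIntegral.integral_mono_on hcd (hint c d hc hcd hd)
          ((hl.intervalIntegrable c d).mul_const M)
          fun v hv => mul_le_mul_of_nonneg_left (hM v hv) (hl0 v)
      obtain ⟨s₁, hs₁, hmax⟩ := isCompact_Icc.exists_isMaxOn (nonempty_Icc.2 hb.1) hu
      have hmax : ∀ s ∈ Icc 0 b, u s ≤ u s₁ := hmax
      set b' := max (b - δ / 2) 0 with hb'
      have hb'0 : 0 ≤ b' := le_max_right _ _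
      have hb'b : b' ≤ b := max_le (by linarith) hb.1
      have hb'δ : b - δ / 2 ≤ b' := le_max_left _ _
      have hold : ∀ s ∈ Icc 0 b', u s ≤ C * ε := by
        refine ih b' ⟨hb'0, hb'b.trans hb.2⟩ (max_le ?_ (by positivity)) u ε hε
          (hu.mono (Icc_subset_Icc_right hb'b)) (fun s hs => hu0 s ⟨hs.1, hs.2.trans hb'b⟩)
          fun s hs => h s ⟨hs.1, hs.2.trans hb'b⟩
        push_cast at hbk
        linarith
      have hM : u s₁ ≤ (2 * (1 + Λ * C) + C) * ε := by
        have hpos : 0 ≤ Λ * C * ε := by positivity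
        rcases le_total s₁ b' with hle | hle
        · have := hold s₁ ⟨hs₁.1, hle⟩
          nlinarith
        · have h1 := h s₁ hs₁
          rw [← intervalIntegral.integral_add_adjacent_intervals (hint 0 b' le_rfl hb'0 hb'b)
            (hint b' s₁ hb'0 hle hs₁.2)] at h1
          have h2 := hmul 0 b' (C * ε) le_rfl hb'0 hb'b hold
          have h3 := hmul b' s₁ (u s₁) hb'0 hle hs₁.2
            fun v hv => hmax v ⟨hb'0.trans hv.1, hv.2.trans hs₁.2⟩
          have h4 := (abs_lt.1 (hsmall b' ⟨hb'0, hb'b.trans hb.2⟩ s₁ ⟨hs₁.1, hs₁.2.trans hb.2⟩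
            (by rw [abs_of_nonneg (by linarith)]; linarith [hs₁.2]))).2
          have h5 : ∫ v in (0 : ℝ)..b', l v ≤ Λ :=
            intervalIntegral.integral_mono_interval le_rfl hb'0
              (hb'b.trans (hb.2.trans (le_abs_self T))) (Eventually.of_forall hl0)
              (hl.intervalIntegrable _ _)
          have h6 := mul_le_mul_of_nonneg_right h5 (show 0 ≤ C * ε by positivity)
          have h7 := mul_le_mul_of_nonneg_right h4.le (hu0 s₁ hs₁)
          have : 0 ≤ C * ε := by positivity
          nlinarith
      exact fun s hs => (hmax s hs).trans hM
  obtain ⟨k, hk⟩ := exists_nat_ge (T / (δ / 2))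
  obtain ⟨C, hC, h⟩ := key k
  refine ⟨C, hC, fun b hb => h b hb (hb.2.trans ?_)⟩
  rwa [div_le_iff₀ (by positivity)] at hk

lemma IsLC.integral_mOpt_le_modulus {f : ℝ → Euc N → Euc N} (hf : IsLC f) {j : ℕ}
    (hequi : ∀ r > (0:ℝ), ∀ ε > (0:ℝ), ∃ δ > (0:ℝ), ∀ τ' s s' : ℝ,
      -r ≤ s → s ≤ s' → s' ≤ r → s' - s < δ → ∫ u in Icc s s', mOpt f j (u + τ') < ε)
    {s : ℝ} (hs : 0 ≤ s) (t : ℝ) :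
    ∫ u in t..(t + s), mOpt f j u ≤
      sSup {v : ℝ | ∃ t : ℝ, v = ∫ u in Icc t (t + s), mOpt f j u} := by
  have hIcc : ∀ c, ∫ u in Icc c (c + s), mOpt f j u = ∫ u in c..(c + s), mOpt f j u := fun c => by
    rw [integral_Icc_eq_integral_Ioc, intervalIntegral.integral_of_le (by linarith)]
  obtain ⟨δ, hδ, h⟩ := hequi 1 one_pos 1 one_pos
  obtain ⟨η, hη0, hη⟩ := exists_between (lt_min hδ one_pos)
  have hstep : ∀ c, ∫ u in c..(c + η), mOpt f j u ≤ 1 := fun c => by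
    have := h c 0 η (by linarith) hη0.le (hη.trans_le (min_le_right _ _)).le
      (by linarith [hη.trans_le (min_le_left _ _)])
    rw [integral_Icc_eq_integral_Ioc, ← intervalIntegral.integral_of_le hη0.le,
      intervalIntegral.integral_comp_add_right (fun u => mOpt f j u), zero_add, add_comm η] at this
    exact this.le
  have hint := fun a b => (hf.locInt_mOpt j).intervalIntegrable a b
  have hsteps : ∀ (k : ℕ) (c : ℝ), ∫ u in c..(c + k * η), mOpt f j u ≤ k := by
    intro k c
    induction k with
    | zero => simp
    | succ k ih =>
      have := hstep (c + k * η)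
      rw [← intervalIntegral.integral_add_adjacent_intervals (hint c (c + k * η)) (hint _ _)]
      push_cast
      rw [show c + (k + 1) * η = c + k * η + η by ring]
      linarith
  obtain ⟨k, hk⟩ := exists_nat_ge (s / η)
  rw [div_le_iff₀ hη0] at hk
  refine le_csSup ⟨k, ?_⟩ ⟨t, (hIcc t).symm⟩
  rintro v ⟨c, rfl⟩
  rw [hIcc]
  refine le_trans ?_ (hsteps k c)
  rw [← intervalIntegral.integral_add_adjacent_intervals (hint c (c + s)) (hint _ (c + k * η))]
  have := hf.mOpt_integral_nonneg j (show c + s ≤ c + k * η by linarith)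
  linarith

lemma IsSolOn.norm_sub_le {f : ℝ → Euc N → Euc N} (hf : IsLC f) {x₀ : Euc N} {y : ℝ → Euc N}
    (hy : IsSolOn f x₀ y) {j : ℕ} {b : ℝ} (hyj : ∀ u ∈ Icc 0 b, ‖y u‖ ≤ j) {s s' : ℝ}
    (hs : 0 ≤ s) (hss' : s ≤ s') (hs' : s' ≤ b) :
    ‖y s' - y s‖ ≤ ∫ u in s..s', mOpt f j u := by
  have hint : ∀ c, 0 ≤ c → c ≤ b → IntervalIntegrable (fun u => f u (y u)) volume 0 c :=
    fun c hc hcb => hf.intervalIntegrable_comp hc (hy.1.mono fun u hu => hu.1)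
      fun u hu => hyj u ⟨hu.1, hu.2.trans hcb⟩
  rw [hy.2 s' (hs.trans hss'), hy.2 s hs, add_sub_add_left_eq_sub,
    intervalIntegral.integral_interval_sub_left (hint s' (hs.trans hss') hs')
      (hint s hs (hss'.trans hs'))]
  exact hf.norm_integral_comp_le hss' fun u hu => hyj u ⟨hs.trans hu.1, hs'.trans' hu.2⟩

/-- Convergence in the `σ_Θ` sense is uniform over all subintervals of a compact interval, when
the moduli control the optimal m-bounds. -/
lemma SigmaTendsto.eventually_norm_integral_le {Θ : SuitableModuli} {f g : ℝ → Euc N → Euc N}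
    (hf : IsLC f) (hg : IsLC g) {ts : ℕ → ℝ}
    (h : SigmaTendsto Θ (fun n => timeTranslate f (ts n)) g) {j : ℕ}
    (hindep : ∀ q₁ q₂ s, 0 ≤ s → Θ.θ j q₁ q₂ s = Θ.θ j 0 0 s)
    (hbound : ∀ t s, 0 ≤ s → ∫ u in t..(t + s), mOpt f j u ≤ Θ.θ j 0 0 s)
    (a b : ℝ) {ε : ℝ} (hε : 0 < ε) :
    ∀ᶠ n in atTop, ∀ z : ℝ → Euc N, Continuous z → (∀ u, ‖z u‖ ≤ j) →
      (∀ u v, ‖z u - z v‖ ≤ Θ.θ j 0 0 |u - v|) → ∀ s ∈ Icc a b,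
        ‖∫ u in a..s, (timeTranslate f (ts n) u (z u) - g u (z u))‖ ≤ ε := by
  obtain ⟨δ₁, hδ₁, hθ⟩ := Metric.continuousOn_iff.1 (Θ.cont j 0 0) 0 self_mem_Ici (ε / 8)
    (by positivity)
  obtain ⟨δ₂, hδ₂, hsmall⟩ := (hg.locInt_mOpt j).exists_abs_integral_lt (a - 1) (b + 1)
    (ε := ε / 8) (by positivity)
  obtain ⟨η, hη0, hη⟩ := exists_rat_btwn (lt_min (lt_min hδ₁ hδ₂) one_pos)
  have hη1 : (η : ℝ) < δ₁ := hη.trans_le ((min_le_left _ _).trans (min_le_left _ _))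
  have hη2 : (η : ℝ) < δ₂ := hη.trans_le ((min_le_left _ _).trans (min_le_right _ _))
  have hη3 : (η : ℝ) < 1 := hη.trans_le (min_le_right _ _)
  have hev : ∀ᶠ n in atTop, ∀ k ∈ Finset.Icc ⌊a / η⌋ ⌊b / η⌋, ∀ x : ℝ → Euc N,
      inK Θ j ((⌊a / (η : ℝ)⌋ : ℚ) * η) ((k : ℚ) * η) x →
      ‖∫ t in Icc (((⌊a / (η : ℝ)⌋ : ℚ) * η : ℚ) : ℝ) (((k : ℚ) * η : ℚ) : ℝ),
        (timeTranslate f (ts n) t (x t) - g t (x t))‖ < ε / 2 :=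
    (Filter.eventually_all_finset _).2 fun k _ => h j _ _ (ε / 2) (by positivity)
  filter_upwards [hev] with n hn z hz hzj hzmod s hs
  set F := fun u => timeTranslate f (ts n) u (z u) - g u (z u) with hF
  have hint1 : ∀ c d, IntervalIntegrable (fun u => timeTranslate f (ts n) u (z u)) volume c d := by
    intro c d
    rcases le_total c d with hcd | hcd
    · exact (hf.translate _).intervalIntegrable_comp hcd hz.continuousOn fun u _ => hzj u
    · exact ((hf.translate _).intervalIntegrable_comp hcd hz.continuousOn fun u _ => hzj u).symm
  have hint2 : ∀ c d, IntervalIntegrable (fun u => g u (z u)) volume c d := by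
    intro c d
    rcases le_total c d with hcd | hcd
    · exact hg.intervalIntegrable_comp hcd hz.continuousOn fun u _ => hzj u
    · exact (hg.intervalIntegrable_comp hcd hz.continuousOn fun u _ => hzj u).symm
  have hint : ∀ c d, IntervalIntegrable F volume c d := fun c d => (hint1 c d).sub (hint2 c d)
  have hshort : ∀ c d, a - 1 ≤ c → c ≤ d → d ≤ b + 1 → d - c ≤ η →
      ‖∫ u in c..d, F u‖ ≤ ε / 4 := by
    intro c d hac hcd hdb hdc
    rw [hF, intervalIntegral.integral_sub (hint1 c d) (hint2 c d)]
    have h1 := (hf.translate (ts n)).norm_integral_comp_le (j := j) hcd fun u _ => hzj u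
    have h2 := hg.norm_integral_comp_le (j := j) hcd fun u _ => hzj u
    have h3 : ∫ u in c..d, mOpt (timeTranslate f (ts n)) j u ≤ Θ.θ j 0 0 (d - c) := by
      have := hbound (c + ts n) (d - c) (by linarith)
      rw [show c + ts n + (d - c) = d + ts n by ring] at this
      rwa [← intervalIntegral.integral_comp_add_right] at this
    have h4 := hθ (d - c) (by simpa using hcd)
      (by rw [Real.dist_eq, sub_zero, abs_of_nonneg (by linarith)]; linarith)
    rw [Θ.zero, Real.dist_eq, sub_zero] at h4
    have h5 := hsmall c ⟨hac, by linarith⟩ d ⟨by linarith, hdb⟩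
      (by rw [abs_of_nonneg (by linarith)]; linarith)
    have h6 := norm_sub_le (∫ u in c..d, timeTranslate f (ts n) u (z u)) (∫ u in c..d, g u (z u))
    linarith [(abs_lt.1 h4).2, (abs_lt.1 h5).2]
  have hgrid : ∀ c : ℝ, (⌊c / η⌋ : ℝ) * η ≤ c ∧ c < (⌊c / η⌋ + 1) * η := fun c =>
    ⟨(le_div_iff₀ hη0).1 (Int.floor_le _), (div_lt_iff₀ hη0).1 (Int.lt_floor_add_one _)⟩
  have hfloor : ⌊a / (η : ℝ)⌋ ≤ ⌊s / (η : ℝ)⌋ := Int.floor_mono (by gcongr; exact hs.1)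
  have hmid : ‖∫ u in ((⌊a / (η : ℝ)⌋ : ℝ) * η)..((⌊s / (η : ℝ)⌋ : ℝ) * η), F u‖ < ε / 2 := by
    have := hn ⌊s / (η : ℝ)⌋ (Finset.mem_Icc.2 ⟨hfloor, Int.floor_mono (by gcongr; exact hs.2)⟩) z
      ⟨hz.continuousOn, fun t _ => hzj t, fun t _ s _ => by
        rw [hindep _ _ _ (abs_nonneg _)]; exact hzmod t s⟩
    push_cast at this
    rwa [integral_Icc_eq_integral_Ioc, ← intervalIntegral.integral_of_le
      (mul_le_mul_of_nonneg_right (by exact_mod_cast hfloor) hη0.le)] at this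
  obtain ⟨ha1, ha2⟩ := hgrid a
  obtain ⟨hs1, hs2⟩ := hgrid s
  have hsb := hs.2
  have has := hs.1
  have hleft := hshort _ a (by linarith) ha1 (by linarith) (by linarith)
  have hright := hshort _ s (by linarith) hs1 (by linarith) (by linarith)
  rw [← intervalIntegral.integral_add_adjacent_intervals (hint a (⌊a / (η : ℝ)⌋ * η)) (hint _ s),
    ← intervalIntegral.integral_add_adjacent_intervals
      (hint (⌊a / (η : ℝ)⌋ * η) (⌊s / (η : ℝ)⌋ * η)) (hint _ s), intervalIntegral.integral_symm]
  refine (norm_add_le _ _).trans ?_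
  rw [norm_neg]
  have := norm_add_le (∫ u in ((⌊a / (η : ℝ)⌋ : ℝ) * η)..((⌊s / (η : ℝ)⌋ : ℝ) * η), F u)
    (∫ u in ((⌊s / (η : ℝ)⌋ : ℝ) * η)..s, F u)
  linarith

/-- Solutions of the approximating equations converge to the solution of the limit equation. -/
lemma SigmaTendsto.eventually_norm_sub_le {Θ : SuitableModuli} {f g : ℝ → Euc N → Euc N}
    (hf : IsLC f) (hg : IsLC g) {ts : ℕ → ℝ}
    (h : SigmaTendsto Θ (fun n => timeTranslate f (ts n)) g)
    (hindep : ∀ j q₁ q₂ s, 0 ≤ s → Θ.θ j q₁ q₂ s = Θ.θ j 0 0 s)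
    (hbound : ∀ j t s, 0 ≤ s → ∫ u in t..(t + s), mOpt f j u ≤ Θ.θ j 0 0 s)
    {r t : ℝ} (ht : 0 ≤ t) {x₀ : Euc N} {x : ℝ → Euc N} (hx : IsSolOn (timeTranslate g r) x₀ x)
    {ε : ℝ} (hε : 0 < ε) :
    ∀ᶠ n in atTop, ∀ y : ℝ → Euc N, IsSolOn (timeTranslate f (ts n + r)) x₀ y →
      ‖y t - x t‖ ≤ ε := by
  have hx0 : x 0 = x₀ := by simpa using hx.2 0 self_mem_Ici
  obtain ⟨B, hB⟩ := isCompact_Icc.exists_bound_of_continuousOn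
    (hx.1.mono fun u (hu : u ∈ Icc 0 t) => hu.1)
  obtain ⟨j, hj⟩ := exists_nat_ge (B + 1)
  have hxj : ∀ s ∈ Icc 0 t, ‖x s‖ + 1 ≤ j := fun s hs => by linarith [hB s hs]
  have hgr := hg.translate r
  obtain ⟨l, hl, hlip⟩ := hgr.2 (Metric.closedBall 0 j) (isCompact_closedBall _ _)
  have hl' : LocInt fun u => |l u| := fun a b => (hl a b).norm
  obtain ⟨C, hC, hgron⟩ := hl'.exists_gronwall (fun u => abs_nonneg _) t
  set κ := min ε (1 / 2) with hκ
  have hκ0 : 0 < κ := by positivity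
  filter_upwards [h.eventually_norm_integral_le hf hg (hindep j) (hbound j) r (r + t)
    (show 0 < κ / (C + 1) by positivity)] with n hn y hy
  have hy0 : y 0 = x₀ := by simpa using hy.2 0 self_mem_Ici
  have hfr := hf.translate (ts n + r)
  have hclose : ∀ b ∈ Icc 0 t, (∀ s ∈ Icc 0 b, ‖y s‖ ≤ j) → ∀ s ∈ Icc 0 b,
      ‖y s - x s‖ ≤ κ := by
    intro b hb hyj
    have hmod : ∀ s s', 0 ≤ s → s ≤ s' → s' ≤ b → ‖y s' - y s‖ ≤ Θ.θ j 0 0 (s' - s) := by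
      intro s s' hs hss' hs'
      refine (hy.norm_sub_le hfr hyj hs hss' hs').trans ?_
      have := hbound j (s + (ts n + r)) (s' - s) (by linarith)
      rw [show s + (ts n + r) + (s' - s) = s' + (ts n + r) by ring] at this
      rwa [← intervalIntegral.integral_comp_add_right] at this
    let c : ℝ → ℝ := fun u => max 0 (min b (u - r))
    have hc : ∀ u, c u ∈ Icc 0 b := fun u => ⟨le_max_left _ _, max_le hb.1 (min_le_left _ _)⟩
    have hcz : ∀ s ∈ Icc 0 b, c (s + r) = s := fun s hs => by
      simp [c, min_eq_right hs.2, max_eq_right hs.1]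
    have hcmono : Monotone c := fun u v huv =>
      max_le_max le_rfl (min_le_min le_rfl (sub_le_sub_right huv r))
    have hcsub : ∀ u v, u ≤ v → c v - c u ≤ v - u := by
      intro u v huv
      have h1 := abs_max_sub_max_le_abs (min b (v - r)) (min b (u - r)) 0
      have h2 := abs_min_sub_min_le_max b (v - r) b (u - r)
      rw [sub_self, abs_zero, max_eq_right (abs_nonneg _), sub_sub_sub_cancel_right,
        abs_of_nonneg (sub_nonneg.2 huv)] at h2
      simp only [c, max_comm (0 : ℝ)]
      exact (le_abs_self _).trans (h1.trans h2)
    have hzmod : ∀ u v, u ≤ v → ‖y (c v) - y (c u)‖ ≤ Θ.θ j 0 0 (v - u) := fun u v huv =>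
      (hmod _ _ (hc u).1 (hcmono huv) (hc v).2).trans
        (Θ.mono j 0 0 (sub_nonneg.2 (hcmono huv)) (sub_nonneg.2 huv) (hcsub u v huv))
    have hF := hn (fun u => y (c u)) (hy.1.comp_continuous (by fun_prop) fun u => (hc u).1)
      (fun u => hyj _ (hc u)) fun u v => by
        rcases le_total u v with huv | huv
        · rw [norm_sub_rev, abs_sub_comm, abs_of_nonneg (sub_nonneg.2 huv)]
          exact hzmod u v huv
        · rw [abs_of_nonneg (sub_nonneg.2 huv)]
          exact hzmod v u huv
    have hysub : ∀ s ∈ Icc 0 b, ContinuousOn y (Icc 0 s) := fun s _ => hy.1.mono fun u hu => hu.1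
    have hxsub : ∀ s ∈ Icc 0 b, ContinuousOn x (Icc 0 s) := fun s _ => hx.1.mono fun u hu => hu.1
    have hyjs : ∀ s ∈ Icc 0 b, ∀ u ∈ Icc 0 s, ‖y u‖ ≤ j := fun s hs u hu =>
      hyj u ⟨hu.1, hu.2.trans hs.2⟩
    have hxjs : ∀ s ∈ Icc 0 b, ∀ u ∈ Icc 0 s, ‖x u‖ ≤ j := fun s hs u hu => by
      linarith [hxj u ⟨hu.1, hu.2.trans (hs.2.trans hb.2)⟩]
    have hineq : ∀ s ∈ Icc 0 b, ‖y s - x s‖ ≤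
        κ / (C + 1) + ∫ v in (0 : ℝ)..s, |l v| * ‖y v - x v‖ := by
      intro s hs
      have i1 := hfr.intervalIntegrable_comp hs.1 (hysub s hs) (hyjs s hs)
      have i2 := hgr.intervalIntegrable_comp hs.1 (hysub s hs) (hyjs s hs)
      have i3 := hgr.intervalIntegrable_comp hs.1 (hxsub s hs) (hxjs s hs)
      have hsplit : y s - x s =
          (∫ v in (0 : ℝ)..s, (timeTranslate f (ts n + r) v (y v) - timeTranslate g r v (y v))) +
          ∫ v in (0 : ℝ)..s, (timeTranslate g r v (y v) - timeTranslate g r v (x v)) := by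
        rw [hy.2 s hs.1, hx.2 s hs.1, intervalIntegral.integral_sub i1 i2,
          intervalIntegral.integral_sub i2 i3]
        abel
      have hfirst : ‖∫ v in (0 : ℝ)..s,
          (timeTranslate f (ts n + r) v (y v) - timeTranslate g r v (y v))‖ ≤ κ / (C + 1) := by
        have := hF (s + r) ⟨by linarith [hs.1], by linarith [hs.2, hb.2]⟩
        rw [← zero_add r, ← add_assoc, add_zero, ← intervalIntegral.integral_comp_add_right
          (fun u => timeTranslate f (ts n) u (y (c u)) - g u (y (c u)))] at this
        convert this using 2
        refine intervalIntegral.integral_congr fun v hv => ?_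
        rw [uIcc_of_le hs.1] at hv
        simp only [timeTranslate, hcz v ⟨hv.1, hv.2.trans hs.2⟩]
        rw [show v + (ts n + r) = v + r + ts n by ring]
      have hsecond : ‖∫ v in (0 : ℝ)..s,
          (timeTranslate g r v (y v) - timeTranslate g r v (x v))‖ ≤
            ∫ v in (0 : ℝ)..s, |l v| * ‖y v - x v‖ := by
        refine intervalIntegral.norm_integral_le_of_norm_le hs.1 ?_
          ((hl'.intervalIntegrable 0 s).mul_continuousOn ?_)
        · filter_upwards [hlip] with v hv hmem
          have hmem := Ioc_subset_Icc_self hmem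
          exact (hv _ (by simpa using hyjs s hs v hmem) _ (by simpa using hxjs s hs v hmem)).trans
            (mul_le_mul_of_nonneg_right (le_abs_self _) (norm_nonneg _))
        · rw [uIcc_of_le hs.1]
          exact ((hysub s hs).sub (hxsub s hs)).norm
      rw [hsplit]
      exact (norm_add_le _ _).trans (add_le_add hfirst hsecond)
    intro s hs
    have hb' : b ∈ Icc 0 b := ⟨hb.1, le_rfl⟩
    refine (hgron b hb (fun v => ‖y v - x v‖) _ (by positivity)
      ((hysub b hb').sub (hxsub b hb')).norm (fun _ _ => norm_nonneg _) hineq s hs).trans ?_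
    rw [mul_div_assoc', div_le_iff₀ (by positivity)]
    nlinarith
  have hynorm : ContinuousOn (fun s => ‖y s‖) (Icc 0 t) := (hy.1.mono fun u hu => hu.1).norm
  have hivt : ∀ s ∈ Icc 0 t, (j : ℝ) ≤ ‖y s‖ → ∃ s' ∈ Icc 0 s, ‖y s'‖ = j := by
    intro s hs hjs
    refine intermediate_value_Icc hs.1 (hynorm.mono (Icc_subset_Icc_right hs.2)) ⟨?_, hjs⟩
    rw [hy0, ← hx0]
    linarith [hxj 0 ⟨le_rfl, ht⟩]
  have hbdd : ∀ s ∈ Icc 0 t, ‖y s‖ ≤ j := by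
    by_contra! hcon
    obtain ⟨s₁, hs₁, hlt⟩ := hcon
    have hcomp : IsCompact (Icc 0 t ∩ (fun s => ‖y s‖) ⁻¹' {(j : ℝ)}) :=
      isCompact_Icc.of_isClosed_subset (hynorm.preimage_isClosed_of_isClosed isClosed_Icc
        isClosed_singleton) inter_subset_left
    obtain ⟨s₂, hs₂, hs₂j⟩ := hivt s₁ hs₁ hlt.le
    obtain ⟨σ, ⟨hσ, hσj⟩, hleast⟩ := hcomp.exists_isLeast
      ⟨s₂, ⟨hs₂.1, hs₂.2.trans hs₁.2⟩, hs₂j⟩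
    have hσj : ‖y σ‖ = j := hσj
    have hσbd : ∀ s ∈ Icc 0 σ, ‖y s‖ ≤ j := by
      intro s hs
      by_contra! hlt
      obtain ⟨s', hs', hs'j⟩ := hivt s ⟨hs.1, hs.2.trans hσ.2⟩ hlt.le
      have hle : σ ≤ s' := hleast ⟨⟨hs'.1, hs'.2.trans (hs.2.trans hσ.2)⟩, hs'j⟩
      have : s = σ := le_antisymm hs.2 (hle.trans hs'.2)
      rw [this, hσj] at hlt
      exact lt_irrefl _ hlt
    have h1 := (hclose σ hσ hσbd σ ⟨hσ.1, le_rfl⟩).trans (min_le_right _ _)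
    have h2 := norm_le_norm_add_norm_sub' (y σ) (x σ)
    linarith [hxj σ hσ]
  exact (hclose t ⟨ht, le_rfl⟩ hbdd t ⟨ht, le_rfl⟩).trans (min_le_left _ _)

end Auxiliary

/-- a bounded pullback absorbing set for the process induced by `f`
yields uniform ultimate boundedness for every `g` in the hull of `f` (a translate
of `f` or a σ_Θ-limit of translates). -/
theorem stmt13 {N : ℕ} (f : ℝ → Euc N → Euc N) (hf : IsLC f)
    (hequi : ∀ j : ℕ, ∀ r > (0:ℝ), ∀ ε > (0:ℝ), ∃ δ > (0:ℝ), ∀ τ' s s' : ℝ,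
      -r ≤ s → s ≤ s' → s' ≤ r → s' - s < δ → ∫ u in Icc s s', mOpt f j (u + τ') < ε)
    (Θ : SuitableModuli)
    (hΘ : ∀ (j : ℕ) (q₁ q₂ : ℚ) (s : ℝ), 0 ≤ s →
      Θ.θ j q₁ q₂ s = sSup {v : ℝ | ∃ t : ℝ, v = ∫ u in Icc t (t + s), mOpt f j u})
    (hfsol : ∀ (r : ℝ) (x₀ : Euc N), ∃ x : ℝ → Euc N, IsSolOn (timeTranslate f r) x₀ x)
    (R : ℝ) (hR : 0 < R)
    (habs : ∀ d > (0:ℝ), ∃ T > (0:ℝ), ∀ (t : ℝ), ∀ s ≥ T, ∀ x₀ : Euc N, ‖x₀‖ ≤ d →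
      ∀ x : ℝ → Euc N, IsSolOn (timeTranslate f (t - s)) x₀ x → ‖x s‖ ≤ R)
    (g : ℝ → Euc N → Euc N) (hg : IsLC g)
    (hghull : (∃ r : ℝ, g = timeTranslate f r) ∨
      (∃ ts : ℕ → ℝ, SigmaTendsto Θ (fun n => timeTranslate f (ts n)) g))
    (hgsol : ∀ (r : ℝ) (x₀ : Euc N), ∃ x : ℝ → Euc N, IsSolOn (timeTranslate g r) x₀ x) :
    ∀ d > (0:ℝ), ∃ T' > (0:ℝ), ∀ (r : ℝ), ∀ t ≥ T', ∀ x₀ : Euc N, ‖x₀‖ ≤ d →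
      ∀ x : ℝ → Euc N, IsSolOn (timeTranslate g r) x₀ x → ‖x t‖ ≤ R := by
  intro d hd
  obtain ⟨T, hT, habs⟩ := habs d hd
  refine ⟨T, hT, fun r t ht x₀ hx₀ x hx => ?_⟩
  rcases hghull with ⟨r₀, rfl⟩ | ⟨ts, hts⟩
  · refine habs (t + (r + r₀)) t ht x₀ hx₀ x ?_
    convert hx using 1
    funext s v
    simp only [timeTranslate]
    congr 1
    ring
  · have hindep : ∀ j q₁ q₂ s, 0 ≤ s → Θ.θ j q₁ q₂ s = Θ.θ j 0 0 s := fun j q₁ q₂ s hs => by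
      rw [hΘ j q₁ q₂ s hs, hΘ j 0 0 s hs]
    have hbound : ∀ j t s, 0 ≤ s → ∫ u in t..(t + s), mOpt f j u ≤ Θ.θ j 0 0 s :=
      fun j t s hs => by
        rw [hΘ j 0 0 s hs]
        exact hf.integral_mOpt_le_modulus (hequi j) hs t
    refine le_of_forall_pos_le_add fun ε hε => ?_
    obtain ⟨n, hn⟩ := (hts.eventually_norm_sub_le hf hg hindep hbound
      (hT.le.trans ht) hx hε).exists
    obtain ⟨y, hy⟩ := hfsol (ts n + r) x₀
    have hyR := habs (t + (ts n + r)) t ht x₀ hx₀ y (by rwa [add_sub_cancel_left])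
    have := norm_le_norm_add_norm_sub (y t) (x t)
    linarith [hn y hy]
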